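/- Monotonicity of g on [ω_opt, 2): for 0 ≤ β < 1 and ω_opt = 2/(1+√(1−β²)), the function ω ↦ ω − 1 is strictly increasing on [ω_opt, 2), and for ω ∈ (0, ω_opt] the value 1 − ω + (1/2)ω²β² + ωβ√(1 − ω + (1/4)ω²β²) is ≥ ω_opt − 1, with equality iff ω = ω_opt. -/

import Mathlib

/-- For `0 ≤ β < 1` and `ω_opt = 2/(1 + √(1-β²))`: the map `ω ↦ ω - 1` is
strictly increasing on `[ω_opt, 2)`, and for `ω ∈ (0, ω_opt]` the value
`1 - ω + ω²β²/2 + ωβ√(1 - ω + ω²β²/4)` is `≥ ω_opt - 1`, with equality iff `ω = ω_opt`. -/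
theorem stmt_11 (β : ℝ) (hβ : 0 ≤ β ∧ β < 1)
    (ωopt : ℝ) (hωopt : ωopt = 2 / (1 + Real.sqrt (1 - β ^ 2))) :
    StrictMonoOn (fun ω : ℝ => ω - 1) (Set.Ico ωopt 2) ∧
      ∀ ω : ℝ, 0 < ω → ω ≤ ωopt →
        (ωopt - 1 ≤ 1 - ω + ω ^ 2 * β ^ 2 / 2 + ω * β * Real.sqrt (1 - ω + ω ^ 2 * β ^ 2 / 4) ∧
          (1 - ω + ω ^ 2 * β ^ 2 / 2 + ω * β * Real.sqrt (1 - ω + ω ^ 2 * β ^ 2 / 4) = ωopt - 1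
            ↔ ω = ωopt)) := by
  obtain ⟨h0, h1⟩ := hβ
  refine ⟨fun a _ b _ h => by simpa using h, ?_⟩
  have hpos : 0 < 1 - β ^ 2 := by nlinarith
  have hs : 0 < Real.sqrt (1 - β ^ 2) := Real.sqrt_pos.2 hpos
  have hs2 : Real.sqrt (1 - β ^ 2) ^ 2 = 1 - β ^ 2 := Real.sq_sqrt hpos.le
  set s := Real.sqrt (1 - β ^ 2) with hsdef
  have hp : 0 < ωopt := by rw [hωopt]; positivity
  have hps : ωopt * (1 + s) = 2 := by rw [hωopt]; field_simp
  have hp2 : ωopt < 2 := by nlinarith [mul_pos hp hs]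
  have hb : ωopt ^ 2 * β ^ 2 = 4 * (ωopt - 1) := by
    have e : ωopt * s = 2 - ωopt := by linarith
    have e2 : ωopt ^ 2 * s ^ 2 = (2 - ωopt) ^ 2 := by rw [← e]; ring
    rw [hs2] at e2
    linarith
  have heq : 1 - ωopt + ωopt ^ 2 * β ^ 2 / 2 +
      ωopt * β * Real.sqrt (1 - ωopt + ωopt ^ 2 * β ^ 2 / 4) = ωopt - 1 := by
    have : 1 - ωopt + ωopt ^ 2 * β ^ 2 / 4 = 0 := by linarith
    rw [this, Real.sqrt_zero]
    linarith
  have hlt : ∀ ω : ℝ, 0 < ω → ω < ωopt → ωopt - 1 <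
      1 - ω + ω ^ 2 * β ^ 2 / 2 + ω * β * Real.sqrt (1 - ω + ω ^ 2 * β ^ 2 / 4) := by
    intro ω hω hlt
    have key : (ωopt * β / 2 - ω * β / 2) ^ 2 < 1 - ω + ω ^ 2 * β ^ 2 / 4 := by
      have h3 : ωopt * (1 - ω + ω ^ 2 * β ^ 2 / 4 - (ωopt * β / 2 - ω * β / 2) ^ 2)
          = (2 - ωopt) * (ωopt - ω) := by
        linear_combination (ω / 2 - ωopt / 4) * hb
      have h4 : 0 < (2 - ωopt) * (ωopt - ω) := mul_pos (by linarith) (by linarith)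
      rw [← h3] at h4
      have := (mul_pos_iff_of_pos_left hp).1 h4
      linarith
    have hr := Real.lt_sqrt_of_sq_lt key
    have hr2 := Real.sq_sqrt ((sq_nonneg _).trans key.le)
    set r := Real.sqrt (1 - ω + ω ^ 2 * β ^ 2 / 4)
    have hb0 : 0 ≤ ωopt * β / 2 := by positivity
    have h5 : (ωopt * β / 2) ^ 2 < (ω * β / 2 + r) ^ 2 :=
      pow_lt_pow_left₀ (by linarith) hb0 (by norm_num)
    nlinarith
  intro ω hω hle
  rcases hle.lt_or_eq with h | h
  · have := hlt ω hω h
    exact ⟨this.le, fun e => absurd e this.ne', fun e => absurd e h.ne⟩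
  · subst h
    exact ⟨heq.ge, fun _ => rfl, fun _ => heq⟩
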